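/- Let k, ℓ be natural numbers with ℓ < k. Then ∫_{-∞}^{+∞} (Q^k_ℓ(i·x))² dx = (2ℓ)!·π·∏_{i=ℓ+2}^{k} (ℓ+i)·(ℓ−i+1), where the product over i from ℓ+2 to k is the empty product, equal to 1, when k = ℓ+1. -/

import Mathlib

open MeasureTheory Filter Finset

/-- Legendre polynomial of the first kind via the Rodrigues formula,
evaluated at a complex argument. -/
noncomputable def legP (l : ℕ) (z : ℂ) : ℂ :=
  (1 / (2 ^ l * (l.factorial : ℂ))) * iteratedDeriv l (fun w : ℂ => (w ^ 2 - 1) ^ l) z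

/-- Legendre function of the second kind `Q_ℓ` (Ferrers branch), for complex argument. -/
noncomputable def legQ (l : ℕ) (z : ℂ) : ℂ :=
  (1 / 2) * legP l z * Complex.log ((1 + z) / (1 - z)) -
    ∑ j ∈ Finset.Icc 1 l, legP (j - 1) z * legP (l - j) z / (j : ℂ)

/-- The associated Legendre function of the second kind on the imaginary axis:
`Q^k_ℓ(i·x) = (−1)^k (1+x²)^{k/2} i^{−k} (d/dx)^k [Q_ℓ(i·x)]`. -/
noncomputable def Qi (k l : ℕ) (x : ℝ) : ℂ :=
  (-1) ^ k * (((1 + x ^ 2) ^ ((k : ℝ) / 2) : ℝ) : ℂ) * Complex.I ^ (-(k : ℤ)) *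
    iteratedDeriv k (fun t : ℝ => legQ l (Complex.I * t)) x

section LegendrePolynomial

open Polynomial

/-- The Legendre polynomial of degree `l`, as a polynomial over `ℂ`. -/
noncomputable def legendrePoly (l : ℕ) : ℂ[X] :=
  C (1 / (2 ^ l * (l.factorial : ℂ))) * derivative^[l] ((X ^ 2 - 1) ^ l)

theorem iteratedDeriv_polynomial_eval (p : ℂ[X]) (n : ℕ) :
    iteratedDeriv n (fun z => p.eval z) = fun z => (derivative^[n] p).eval z := by
  induction n with
  | zero => simp
  | succ n ih =>
    rw [iteratedDeriv_succ, ih]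
    ext z
    rw [Polynomial.deriv, Function.iterate_succ_apply']

theorem legP_eq_eval (l : ℕ) (z : ℂ) : legP l z = (legendrePoly l).eval z := by
  have h := congrFun (iteratedDeriv_polynomial_eval ((X ^ 2 - 1) ^ l) l) z
  simp only [eval_pow, eval_sub, eval_X, eval_one] at h
  rw [legP, legendrePoly, eval_mul, eval_C, h]

theorem natDegree_legendrePoly_le (l : ℕ) : (legendrePoly l).natDegree ≤ l := by
  refine (natDegree_C_mul_le _ _).trans ((natDegree_iterate_derivative _ _).trans ?_)
  have h : ((X ^ 2 - 1 : ℂ[X]) ^ l).natDegree ≤ l * 2 := by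
    refine natDegree_pow_le_of_le l ?_
    compute_degree
  omega

theorem eval_one_legendrePoly (l : ℕ) : (legendrePoly l).eval 1 = 1 := by
  have h := aeval_iterate_derivative_self (A := ℂ) ((X ^ 2 - 1 : ℂ[X]) ^ l) l 1 (p' := (X + 1) ^ l)
    (by rw [Algebra.algebraMap_self, Polynomial.map_id, ← mul_pow, C_1]; ring)
  rw [coe_aeval_eq_eval] at h
  have hl : (l.factorial : ℂ) ≠ 0 := by exact_mod_cast l.factorial_ne_zero
  rw [legendrePoly, eval_mul, eval_C, h]
  simp only [eval_pow, eval_add, eval_X, eval_one, nsmul_eq_mul]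
  norm_num
  field_simp

theorem iterate_derivative_sq_sub_one_pow (l n : ℕ) :
    (X ^ 2 - 1) * derivative^[n + 2] ((X ^ 2 - 1 : ℂ[X]) ^ l) =
      2 * ((l : ℂ[X]) - (n : ℂ[X]) - 1) * X * derivative^[n + 1] ((X ^ 2 - 1) ^ l) +
        ((n : ℂ[X]) + 1) * (2 * (l : ℂ[X]) - (n : ℂ[X])) * derivative^[n] ((X ^ 2 - 1) ^ l) := by
  set h : ℂ[X] := (X ^ 2 - 1) ^ l with hh
  have h0 : (X ^ 2 - 1) * derivative h = 2 * (l : ℂ[X]) * X * h := by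
    rcases l with _ | l
    · simp [hh]
    · rw [hh, derivative_pow]
      simp
      ring
  induction n with
  | zero =>
    have := congrArg derivative h0
    simp only [derivative_mul, derivative_sub, derivative_X_pow, derivative_one, derivative_X,
      derivative_natCast, derivative_ofNat, Nat.cast_ofNat, C_ofNat] at this
    simp only [Function.iterate_succ_apply', Function.iterate_zero_apply]
    push_cast
    linear_combination this
  | succ n ih =>
    have := congrArg derivative ih
    simp only [derivative_mul, derivative_sub, derivative_add, derivative_X_pow, derivative_one,
      derivative_X, derivative_natCast, derivative_ofNat, ← Function.iterate_succ_apply' derivative,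
      Nat.cast_ofNat, C_ofNat] at this
    push_cast
    linear_combination this

theorem legendrePoly_ode (l : ℕ) :
    (X ^ 2 - 1) * derivative (derivative (legendrePoly l)) + 2 * X * derivative (legendrePoly l) =
      (l : ℂ[X]) * ((l : ℂ[X]) + 1) * legendrePoly l := by
  have h := iterate_derivative_sq_sub_one_pow l l
  simp only [legendrePoly, derivative_C_mul, ← Function.iterate_succ_apply' derivative]
  linear_combination C (1 / (2 ^ l * (l.factorial : ℂ))) * h

/-- The polynomial `x ↦ i P_l(i x)`. -/
noncomputable def legendrePolyImag (l : ℕ) : ℂ[X] :=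
  C Complex.I * (legendrePoly l).comp (C Complex.I * X)

theorem natDegree_legendrePoly_comp_le (l : ℕ) :
    ((legendrePoly l).comp (C Complex.I * X)).natDegree ≤ l := by
  refine natDegree_comp_le.trans ?_
  rw [natDegree_C_mul_X _ Complex.I_ne_zero, mul_one]
  exact natDegree_legendrePoly_le l

theorem natDegree_legendrePolyImag_le (l : ℕ) : (legendrePolyImag l).natDegree ≤ l :=
  (natDegree_C_mul_le _ _).trans (natDegree_legendrePoly_comp_le l)

theorem eval_neg_I_legendrePolyImag (l : ℕ) :
    (legendrePolyImag l).eval (-Complex.I) = Complex.I := by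
  simp [legendrePolyImag, eval_one_legendrePoly]

theorem legendrePolyImag_ode (l : ℕ) :
    (1 + X ^ 2) * derivative (derivative (legendrePolyImag l)) +
      2 * X * derivative (legendrePolyImag l) = (l : ℂ[X]) * ((l : ℂ[X]) + 1) * legendrePolyImag l := by
  have h := congrArg (fun p => p.comp (C Complex.I * X)) (legendrePoly_ode l)
  have hI : (C Complex.I : ℂ[X]) ^ 2 = -1 := by
    rw [← C_pow, Complex.I_sq, C_neg, C_1]
  simp only [mul_comp, add_comp, sub_comp, X_pow_comp, X_comp, one_comp, natCast_comp,
    ofNat_comp] at h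
  simp only [legendrePolyImag, derivative_comp, derivative_mul, derivative_C,
    derivative_X, zero_mul, zero_add, mul_one]
  linear_combination (C Complex.I) * h + (C Complex.I * (1 + X ^ 2) *
    ((derivative (derivative (legendrePoly l))).comp (C Complex.I * X)) -
    C Complex.I * X ^ 2 * ((derivative (derivative (legendrePoly l))).comp (C Complex.I * X))) * hI

end LegendrePolynomial

section PolynomialMulArctan

open Polynomial

/-- The numerator over `(1 + X ^ 2) ^ n` of the rational part of the `n`-th derivative
of `p * arctan`. -/
noncomputable def arctanNumerator (p : ℂ[X]) : ℕ → ℂ[X]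
  | 0 => 0
  | n + 1 => derivative^[n] p * (1 + X ^ 2) ^ n +
      (1 + X ^ 2) * derivative (arctanNumerator p n) - 2 * (n : ℂ[X]) * X * arctanNumerator p n

/-- The `n`-th derivative of `x ↦ p(x) * arctan x` on the real line. -/
noncomputable def polyArctan (p : ℂ[X]) (n : ℕ) (x : ℝ) : ℂ :=
  (derivative^[n] p).eval (x : ℂ) * (Real.arctan x : ℂ) +
    (arctanNumerator p n).eval (x : ℂ) / (1 + (x : ℂ) ^ 2) ^ n

theorem one_add_ofReal_sq_ne_zero (x : ℝ) : 1 + (x : ℂ) ^ 2 ≠ 0 := by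
  exact_mod_cast (by positivity : 1 + x ^ 2 ≠ 0)

theorem hasDerivAt_one_add_ofReal_sq (x : ℝ) :
    HasDerivAt (fun t : ℝ => 1 + (t : ℂ) ^ 2) (2 * (x : ℂ)) x := by
  simpa using (((hasDerivAt_id (x : ℂ)).pow 2).const_add 1).comp_ofReal

theorem hasDerivAt_polyArctan (p : ℂ[X]) (n : ℕ) (x : ℝ) :
    HasDerivAt (polyArctan p n) (polyArctan p (n + 1) x) x := by
  have hx := one_add_ofReal_sq_ne_zero x
  have hA := (Real.hasDerivAt_arctan' x).ofReal_comp
  have h := ((((derivative^[n] p).hasDerivAt (x : ℂ)).comp_ofReal).mul hA).add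
    ((((arctanNumerator p n).hasDerivAt (x : ℂ)).comp_ofReal).div
      ((hasDerivAt_one_add_ofReal_sq x).pow n) (pow_ne_zero n hx))
  refine h.congr_deriv ?_
  rw [polyArctan, arctanNumerator, Function.iterate_succ_apply']
  simp only [eval_add, eval_sub, eval_mul, eval_pow, eval_one, eval_X, eval_natCast, eval_ofNat]
  push_cast
  rcases n with _ | n
  · simp
    field_simp
    ring
  · simp only [Pi.pow_apply, Nat.add_sub_cancel]
    push_cast
    field_simp
    ring

theorem polyArctan_ode {p : ℂ[X]} {l : ℕ}
    (hp : (1 + X ^ 2) * derivative (derivative p) + 2 * X * derivative p =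
      (l : ℂ[X]) * ((l : ℂ[X]) + 1) * p) (n : ℕ) (x : ℝ) :
    (1 + (x : ℂ) ^ 2) * polyArctan p (n + 2) x + 2 * (n + 1) * x * polyArctan p (n + 1) x +
      (n * (n + 1) - l * (l + 1)) * polyArctan p n x =
        2 * (derivative^[n + 1] p).eval (x : ℂ) := by
  induction n generalizing x with
  | zero =>
    have hx := one_add_ofReal_sq_ne_zero x
    have h := congrArg (eval (x : ℂ)) hp
    simp only [eval_add, eval_mul, eval_pow, eval_one, eval_X, eval_natCast, eval_ofNat] at h
    simp only [polyArctan, arctanNumerator, Function.iterate_succ_apply',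
      Function.iterate_zero_apply, eval_add, eval_sub, eval_mul, eval_pow, eval_one, eval_X,
      eval_natCast, eval_ofNat, eval_zero, derivative_zero]
    simp [-Complex.ofReal_arctan]
    field_simp
    linear_combination (Real.arctan x : ℂ) * (1 + (x : ℂ) ^ 2) * h
  | succ n ih =>
    have hf := ((((hasDerivAt_one_add_ofReal_sq x).mul (hasDerivAt_polyArctan p (n + 2) x)).add
      ((((hasDerivAt_id (x : ℂ)).comp_ofReal).const_mul (2 * ((n : ℂ) + 1))).mul
        (hasDerivAt_polyArctan p (n + 1) x))).add
      ((hasDerivAt_polyArctan p n x).const_mul ((n : ℂ) * (n + 1) - l * (l + 1))))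
    have hg := (((derivative^[n + 1] p).hasDerivAt (x : ℂ)).comp_ofReal).const_mul 2
    have := (hf.congr_of_eventuallyEq (Eventually.of_forall fun y => (ih y).symm)).unique hg
    rw [Function.iterate_succ_apply' derivative (n + 1), ← this]
    simp only [id]
    push_cast
    ring

theorem polyArctan_of_natDegree_lt {p : ℂ[X]} {n : ℕ} (hn : p.natDegree < n) (x : ℝ) :
    polyArctan p n x = (arctanNumerator p n).eval (x : ℂ) / (1 + (x : ℂ) ^ 2) ^ n := by
  rw [polyArctan, iterate_derivative_eq_zero hn, eval_zero, zero_mul, zero_add]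

theorem eval_neg_I_arctanNumerator (p : ℂ[X]) (n : ℕ) :
    (arctanNumerator p (n + 1)).eval (-Complex.I) =
      (2 * Complex.I) ^ n * (n.factorial : ℂ) * p.eval (-Complex.I) := by
  induction n with
  | zero => simp [arctanNumerator]
  | succ n ih =>
    rw [arctanNumerator]
    simp only [eval_add, eval_sub, eval_mul, eval_pow, eval_one, eval_X, eval_natCast, eval_ofNat,
      ih, neg_sq, Complex.I_sq, Nat.factorial_succ]
    push_cast
    ring

theorem derivative_arctanNumerator_eq_zero {p : ℂ[X]} {l : ℕ} (hl : p.natDegree ≤ l)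
    (hp : (1 + X ^ 2) * derivative (derivative p) + 2 * X * derivative p =
      (l : ℂ[X]) * ((l : ℂ[X]) + 1) * p) :
    derivative (arctanNumerator p (l + 1)) = 0 := by
  refine eq_zero_of_infinite_isRoot _
    ((Set.infinite_range_of_injective Complex.ofReal_injective).mono ?_)
  rintro _ ⟨x, rfl⟩
  have hx := one_add_ofReal_sq_ne_zero x
  have h := polyArctan_ode hp l x
  rw [iterate_derivative_eq_zero (by omega : p.natDegree < l + 1), sub_self, zero_mul, add_zero,
    polyArctan_of_natDegree_lt (by omega), polyArctan_of_natDegree_lt (by omega),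
    arctanNumerator, iterate_derivative_eq_zero (by omega : p.natDegree < l + 1)] at h
  simp only [eval_add, eval_sub, eval_mul, eval_pow, eval_one, eval_X, eval_natCast, eval_ofNat,
    eval_zero] at h
  push_cast at h
  field_simp at h
  have h' : (1 + (x : ℂ) ^ 2) ^ (l + 3) *
      (derivative (arctanNumerator p (l + 1))).eval (x : ℂ) = 0 := by
    linear_combination h
  exact (mul_eq_zero.mp h').resolve_left (pow_ne_zero _ hx)

theorem polyArctan_succ_eq {p : ℂ[X]} {l : ℕ} (hl : p.natDegree ≤ l)
    (hp : (1 + X ^ 2) * derivative (derivative p) + 2 * X * derivative p =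
      (l : ℂ[X]) * ((l : ℂ[X]) + 1) * p) (x : ℝ) :
    polyArctan p (l + 1) x = (2 * Complex.I) ^ l * (l.factorial : ℂ) * p.eval (-Complex.I) /
      (1 + (x : ℂ) ^ 2) ^ (l + 1) := by
  have h := eq_C_of_derivative_eq_zero (derivative_arctanNumerator_eq_zero hl hp)
  rw [polyArctan_of_natDegree_lt (by omega), ← eval_neg_I_arctanNumerator, h, eval_C, eval_C]

end PolynomialMulArctan

section Integration

theorem integrable_inv_one_add_sq_pow (n : ℕ) :
    Integrable fun x : ℝ => ((1 + x ^ 2) ^ (n + 1))⁻¹ := by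
  refine integrable_inv_one_add_sq.mono' ?_ (Eventually.of_forall fun x => ?_)
  · exact (Continuous.inv₀ (by fun_prop) fun x => by positivity).aestronglyMeasurable
  · rw [Real.norm_of_nonneg (by positivity)]
    exact inv_anti₀ (by positivity) (le_self_pow₀ (by nlinarith [sq_nonneg x]) (by omega))

theorem tendsto_sqrt_one_add_sq_atTop : Tendsto (fun x : ℝ => √(1 + x ^ 2)) atTop atTop :=
  tendsto_atTop_mono (fun x => Real.abs_le_sqrt (by linarith)) tendsto_abs_atTop_atTop

theorem tendsto_sqrt_one_add_sq_atBot : Tendsto (fun x : ℝ => √(1 + x ^ 2)) atBot atTop :=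
  tendsto_atTop_mono (fun x => Real.abs_le_sqrt (by linarith)) tendsto_abs_atBot_atTop

theorem tendsto_zero_of_norm_mul_le {f : ℝ → ℂ} {s : ℝ → ℝ} {L : Filter ℝ} {C : ℝ}
    (hs : Tendsto s L atTop) (hf : ∀ x, ‖f x‖ * s x ≤ C) : Tendsto f L (nhds 0) := by
  refine squeeze_zero_norm' (a := fun x => C / s x) ?_ (hs.const_div_atTop C)
  filter_upwards [hs.eventually_gt_atTop 0] with x hx
  exact (le_div_iff₀ hx).mpr (hf x)

theorem integral_inv_one_add_sq_pow (n : ℕ) :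
    ∫ x : ℝ, ((1 + x ^ 2) ^ (n + 1))⁻¹ =
      Real.pi * ((2 * n).factorial : ℝ) / (4 ^ n * (n.factorial : ℝ) ^ 2) := by
  induction n with
  | zero => simp
  | succ n ih =>
    have hd (x : ℝ) : HasDerivAt (fun x : ℝ => x * ((1 + x ^ 2) ^ (n + 1))⁻¹)
        (2 * (n + 1) * ((1 + x ^ 2) ^ (n + 1 + 1))⁻¹ -
          (2 * n + 1) * ((1 + x ^ 2) ^ (n + 1))⁻¹) x := by
      have hx : (1 + x ^ 2) ≠ 0 := by positivity
      have h := (hasDerivAt_id x).mul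
        (((((hasDerivAt_id x).pow 2).const_add 1).pow (n + 1)).inv (pow_ne_zero _ hx))
      refine h.congr_deriv ?_
      simp
      field_simp
      ring
    have hb (x : ℝ) : ‖((x * ((1 + x ^ 2) ^ (n + 1))⁻¹ : ℝ) : ℂ)‖ * √(1 + x ^ 2) ≤ 1 := by
      have h0 : 0 < 1 + x ^ 2 := by positivity
      rw [Complex.norm_real, Real.norm_eq_abs, abs_mul, abs_of_pos (by positivity :
        0 < ((1 + x ^ 2) ^ (n + 1))⁻¹), mul_right_comm, ← div_eq_mul_inv, div_le_one (by positivity)]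
      calc |x| * √(1 + x ^ 2) ≤ √(1 + x ^ 2) * √(1 + x ^ 2) := by
            gcongr
            exact Real.abs_le_sqrt (by linarith)
        _ = 1 + x ^ 2 := Real.mul_self_sqrt h0.le
        _ ≤ (1 + x ^ 2) ^ (n + 1) := le_self_pow₀ (by nlinarith [sq_nonneg x]) (by omega)
    have hlim {L : Filter ℝ} (hL : Tendsto (fun x : ℝ => √(1 + x ^ 2)) L atTop) :
        Tendsto (fun x : ℝ => x * ((1 + x ^ 2) ^ (n + 1))⁻¹) L (nhds 0) := by
      have := (Complex.continuous_re.tendsto 0).comp (tendsto_zero_of_norm_mul_le hL hb)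
      simpa only [Function.comp_def, Complex.ofReal_re, Complex.zero_re] using this
    have hi1 := (integrable_inv_one_add_sq_pow (n + 1)).const_mul (2 * (n + 1) : ℝ)
    have hi2 := (integrable_inv_one_add_sq_pow n).const_mul (2 * n + 1 : ℝ)
    have h := integral_of_hasDerivAt_of_tendsto hd (hi1.sub hi2)
      (hlim tendsto_sqrt_one_add_sq_atBot) (hlim tendsto_sqrt_one_add_sq_atTop)
    rw [integral_sub hi1 hi2, integral_const_mul, integral_const_mul, ih, sub_zero, sub_eq_zero] at h
    have hn : (2 * ((n : ℝ) + 1)) ≠ 0 := by positivity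
    apply mul_left_cancel₀ hn
    rw [h, show 2 * (n + 1) = 2 * n + 1 + 1 by ring, Nat.factorial_succ, Nat.factorial_succ,
      Nat.factorial_succ n]
    push_cast
    field_simp
    ring

theorem norm_one_add_ofReal_sq (x : ℝ) : ‖1 + (x : ℂ) ^ 2‖ = √(1 + x ^ 2) ^ 2 := by
  have h : 1 + (x : ℂ) ^ 2 = ((1 + x ^ 2 : ℝ) : ℂ) := by push_cast; rfl
  rw [Real.sq_sqrt (by positivity), h, Complex.norm_of_nonneg (by positivity)]

/-- The family `V` of successive derivatives of a solution of the Legendre equation on the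
imaginary axis satisfies the differentiated equations, from order `l` on. -/
def IsLegendreFamily (l : ℕ) (V : ℕ → ℝ → ℂ) : Prop :=
  (∀ n x, HasDerivAt (V n) (V (n + 1) x) x) ∧
    ∀ n, l ≤ n → ∀ x : ℝ, (1 + (x : ℂ) ^ 2) * V (n + 2) x + 2 * (n + 1) * x * V (n + 1) x +
      (n * (n + 1) - l * (l + 1)) * V n x = 0

namespace IsLegendreFamily

variable {l : ℕ} {V : ℕ → ℝ → ℂ} {c : ℂ}

theorem exists_bound_aux (hV : IsLegendreFamily l V)
    (hc : ∀ x : ℝ, V (l + 1) x = c / (1 + (x : ℂ) ^ 2) ^ (l + 1)) {n : ℕ} (hn : l ≤ n) :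
    (∃ C, ∀ x : ℝ, ‖((n : ℂ) * (n + 1) - l * (l + 1)) * V n x‖ * √(1 + x ^ 2) ^ (n + l + 1) ≤ C) ∧
      ∃ C, ∀ x : ℝ, ‖V (n + 1) x‖ * √(1 + x ^ 2) ^ (n + 1 + l + 1) ≤ C := by
  induction n, hn using Nat.le_induction with
  | base =>
    refine ⟨⟨0, fun x => by simp⟩, ‖c‖, fun x => ?_⟩
    have hs : 0 < √(1 + x ^ 2) := by positivity
    rw [hc, norm_div, norm_pow, norm_one_add_ofReal_sq, ← pow_mul,
      show l + 1 + l + 1 = 2 * (l + 1) by ring, div_mul_cancel₀ _ (by positivity)]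
  | succ n hn ih =>
    obtain ⟨⟨C, hC⟩, D, hD⟩ := ih
    refine ⟨⟨‖(((n + 1 : ℕ) : ℂ) * ((n + 1 : ℕ) + 1) - l * (l + 1))‖ * D, fun x => ?_⟩,
      2 * (n + 1) * D + C, fun x => ?_⟩
    · rw [norm_mul, mul_assoc]
      exact mul_le_mul_of_nonneg_left (hD x) (norm_nonneg _)
    · have hs : 0 < √(1 + x ^ 2) := by positivity
      have hxs : |x| ≤ √(1 + x ^ 2) := Real.abs_le_sqrt (by linarith)
      have h : (1 + (x : ℂ) ^ 2) * V (n + 2) x =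
          -(2 * (n + 1) * x * V (n + 1) x + ((n : ℂ) * (n + 1) - l * (l + 1)) * V n x) := by
        linear_combination hV.2 n hn x
      have h' := congrArg norm h
      rw [norm_mul, norm_one_add_ofReal_sq, norm_neg] at h'
      have hk : ‖2 * ((n : ℂ) + 1) * x * V (n + 1) x‖ = 2 * (n + 1) * |x| * ‖V (n + 1) x‖ := by
        rw [norm_mul, norm_mul, norm_mul, Complex.norm_real, Real.norm_eq_abs]
        norm_cast
      calc ‖V (n + 2) x‖ * √(1 + x ^ 2) ^ (n + 1 + 1 + l + 1)
          = √(1 + x ^ 2) ^ 2 * ‖V (n + 2) x‖ * √(1 + x ^ 2) ^ (n + l + 1) := by ring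
        _ ≤ (2 * (n + 1) * √(1 + x ^ 2) * ‖V (n + 1) x‖ +
              ‖((n : ℂ) * (n + 1) - l * (l + 1)) * V n x‖) * √(1 + x ^ 2) ^ (n + l + 1) := by
            rw [h']
            gcongr
            refine (norm_add_le _ _).trans ?_
            rw [hk]
            gcongr
        _ = 2 * (n + 1) * (‖V (n + 1) x‖ * √(1 + x ^ 2) ^ (n + 1 + l + 1)) +
              ‖((n : ℂ) * (n + 1) - l * (l + 1)) * V n x‖ * √(1 + x ^ 2) ^ (n + l + 1) := by ring
        _ ≤ 2 * (n + 1) * D + C := by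
            gcongr
            · exact hD x
            · exact hC x

theorem exists_bound (hV : IsLegendreFamily l V)
    (hc : ∀ x : ℝ, V (l + 1) x = c / (1 + (x : ℂ) ^ 2) ^ (l + 1)) {n : ℕ} (hn : l < n) :
    ∃ C, ∀ x : ℝ, ‖V n x‖ * √(1 + x ^ 2) ^ (n + l + 1) ≤ C := by
  obtain ⟨n, rfl⟩ : ∃ m, n = m + 1 := ⟨n - 1, by omega⟩
  exact (hV.exists_bound_aux hc (by omega : l ≤ n)).2

theorem integrable_weight_mul_sq (hV : IsLegendreFamily l V)
    (hc : ∀ x : ℝ, V (l + 1) x = c / (1 + (x : ℂ) ^ 2) ^ (l + 1)) {n : ℕ} (hn : l < n) :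
    Integrable fun x : ℝ => (1 + (x : ℂ) ^ 2) ^ n * V n x ^ 2 := by
  obtain ⟨C, hC⟩ := hV.exists_bound hc hn
  have hcont : Continuous (V n) :=
    continuous_iff_continuousAt.mpr fun x => (hV.1 n x).continuousAt
  refine ((integrable_inv_one_add_sq_pow l).const_mul (C ^ 2)).mono' ?_
    (Eventually.of_forall fun x => ?_)
  · exact Continuous.aestronglyMeasurable (by fun_prop)
  · have hs : 0 < √(1 + x ^ 2) := by positivity
    have hs2 : (1 + x ^ 2) ^ (l + 1) = (√(1 + x ^ 2) ^ 2) ^ (l + 1) := by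
      rw [Real.sq_sqrt (by positivity)]
    rw [norm_mul, norm_pow, norm_pow, norm_one_add_ofReal_sq, ← div_eq_mul_inv,
      le_div_iff₀ (by positivity), hs2]
    calc (√(1 + x ^ 2) ^ 2) ^ n * ‖V n x‖ ^ 2 * (√(1 + x ^ 2) ^ 2) ^ (l + 1)
        = (‖V n x‖ * √(1 + x ^ 2) ^ (n + l + 1)) ^ 2 := by ring
      _ ≤ C ^ 2 := by
        gcongr
        exact hC x

theorem integral_succ (hV : IsLegendreFamily l V)
    (hc : ∀ x : ℝ, V (l + 1) x = c / (1 + (x : ℂ) ^ 2) ^ (l + 1)) {n : ℕ} (hn : l < n) :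
    ∫ x : ℝ, (1 + (x : ℂ) ^ 2) ^ (n + 1) * V (n + 1) x ^ 2 =
      ((n : ℂ) * (n + 1) - l * (l + 1)) * ∫ x : ℝ, (1 + (x : ℂ) ^ 2) ^ n * V n x ^ 2 := by
  obtain ⟨C, hC⟩ := hV.exists_bound hc hn
  obtain ⟨D, hD⟩ := hV.exists_bound hc (hn.trans n.lt_succ_self)
  have hd (x : ℝ) : HasDerivAt (fun x : ℝ => V n x * ((1 + (x : ℂ) ^ 2) ^ (n + 1) * V (n + 1) x))
      ((1 + (x : ℂ) ^ 2) ^ (n + 1) * V (n + 1) x ^ 2 -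
        ((n : ℂ) * (n + 1) - l * (l + 1)) * ((1 + (x : ℂ) ^ 2) ^ n * V n x ^ 2)) x := by
    have h := (hV.1 n x).mul (((hasDerivAt_one_add_ofReal_sq x).pow (n + 1)).mul (hV.1 (n + 1) x))
    refine h.congr_deriv ?_
    simp only [Pi.pow_apply, Pi.mul_apply, Nat.add_sub_cancel]
    push_cast
    linear_combination (V n x * (1 + (x : ℂ) ^ 2) ^ n) * hV.2 n hn.le x
  have hb (x : ℝ) :
      ‖V n x * ((1 + (x : ℂ) ^ 2) ^ (n + 1) * V (n + 1) x)‖ * √(1 + x ^ 2) ≤ C * D := by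
    have hs : 1 ≤ √(1 + x ^ 2) := Real.one_le_sqrt.mpr (by nlinarith [sq_nonneg x])
    rw [norm_mul, norm_mul, norm_pow, norm_one_add_ofReal_sq]
    calc ‖V n x‖ * ((√(1 + x ^ 2) ^ 2) ^ (n + 1) * ‖V (n + 1) x‖) * √(1 + x ^ 2)
        = ‖V n x‖ * ‖V (n + 1) x‖ * √(1 + x ^ 2) ^ (2 * n + 3) := by ring
      _ ≤ ‖V n x‖ * ‖V (n + 1) x‖ * √(1 + x ^ 2) ^ (2 * n + 3 + 2 * l) := by
          exact mul_le_mul_of_nonneg_left (pow_le_pow_right₀ hs (by omega)) (by positivity)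
      _ = (‖V n x‖ * √(1 + x ^ 2) ^ (n + l + 1)) *
            (‖V (n + 1) x‖ * √(1 + x ^ 2) ^ (n + 1 + l + 1)) := by ring
      _ ≤ C * D := mul_le_mul (hC x) (hD x) (by positivity) (le_trans (by positivity) (hC x))
  have hi1 := hV.integrable_weight_mul_sq hc (hn.trans n.lt_succ_self)
  have hi2 := (hV.integrable_weight_mul_sq hc hn).const_mul ((n : ℂ) * (n + 1) - l * (l + 1))
  have h := integral_of_hasDerivAt_of_tendsto hd (hi1.sub hi2)
    (tendsto_zero_of_norm_mul_le tendsto_sqrt_one_add_sq_atBot hb)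
    (tendsto_zero_of_norm_mul_le tendsto_sqrt_one_add_sq_atTop hb)
  rwa [integral_sub hi1 hi2, integral_const_mul, sub_zero, sub_eq_zero] at h

theorem integral_base (hc : ∀ x : ℝ, V (l + 1) x = c / (1 + (x : ℂ) ^ 2) ^ (l + 1)) :
    ∫ x : ℝ, (1 + (x : ℂ) ^ 2) ^ (l + 1) * V (l + 1) x ^ 2 =
      c ^ 2 * (Real.pi * ((2 * l).factorial : ℂ) / (4 ^ l * (l.factorial : ℂ) ^ 2)) := by
  have h (x : ℝ) : (1 + (x : ℂ) ^ 2) ^ (l + 1) * V (l + 1) x ^ 2 =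
      c ^ 2 * ((((1 + x ^ 2) ^ (l + 1))⁻¹ : ℝ) : ℂ) := by
    have hx := one_add_ofReal_sq_ne_zero x
    rw [hc]
    push_cast
    field_simp
  simp_rw [h]
  rw [integral_const_mul, integral_complex_ofReal, integral_inv_one_add_sq_pow]
  push_cast
  rfl

end IsLegendreFamily

end Integration

section LegendreQ

open Polynomial

theorem isLegendreFamily_polyArctan (l : ℕ) :
    IsLegendreFamily l (polyArctan (legendrePolyImag l)) := by
  refine ⟨hasDerivAt_polyArctan _, fun n hn x => ?_⟩
  rw [polyArctan_ode (legendrePolyImag_ode l), iterate_derivative_eq_zero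
    (Nat.lt_succ_of_le ((natDegree_legendrePolyImag_le l).trans hn)), eval_zero, mul_zero]

theorem exists_legQ_imag_eq (l : ℕ) : ∃ w : ℂ[X], derivative^[l] w = 0 ∧
    (fun t : ℝ => legQ l (Complex.I * t)) =
      fun t : ℝ => polyArctan (legendrePolyImag l) 0 t - w.eval (t : ℂ) := by
  refine ⟨∑ j ∈ Finset.Icc 1 l, C (1 / (j : ℂ)) *
    ((legendrePoly (j - 1)).comp (C Complex.I * X) * (legendrePoly (l - j)).comp (C Complex.I * X)),
    ?_, ?_⟩
  · rw [iterate_derivative_sum]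
    refine Finset.sum_eq_zero fun j hj => iterate_derivative_eq_zero ?_
    rw [Finset.mem_Icc] at hj
    have h := (natDegree_C_mul_le (1 / (j : ℂ)) _).trans (natDegree_mul_le_of_le
      (natDegree_legendrePoly_comp_le (j - 1)) (natDegree_legendrePoly_comp_le (l - j)))
    omega
  · ext t
    have hlog : Complex.log ((1 + Complex.I * t) / (1 - Complex.I * t)) =
        2 * Complex.I * (Real.arctan t : ℂ) := by
      rw [Complex.ofReal_arctan, Complex.arctan, mul_comm Complex.I]
      linear_combination Complex.log ((1 + t * Complex.I) / (1 - t * Complex.I)) * Complex.I_sq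
    rw [legQ, hlog, polyArctan, eval_finsetSum]
    simp only [legP_eq_eval, legendrePolyImag, arctanNumerator, Function.iterate_zero_apply,
      eval_mul, eval_comp, eval_C, eval_X, eval_zero, zero_div, add_zero]
    congr 1
    · ring
    · exact Finset.sum_congr rfl fun j _ => by ring

theorem iteratedDeriv_legQ_imag {k l : ℕ} (hl : l < k) :
    iteratedDeriv k (fun t : ℝ => legQ l (Complex.I * t)) = polyArctan (legendrePolyImag l) k := by
  obtain ⟨w, hw, h⟩ := exists_legQ_imag_eq l
  have key (n : ℕ) : iteratedDeriv n (fun t : ℝ => legQ l (Complex.I * t)) = fun t : ℝ =>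
      polyArctan (legendrePolyImag l) n t - (derivative^[n] w).eval (t : ℂ) := by
    induction n with
    | zero => simpa using h
    | succ n ih =>
      rw [iteratedDeriv_succ, ih]
      ext t
      rw [Function.iterate_succ_apply']
      exact ((hasDerivAt_polyArctan _ n t).sub
        ((derivative^[n] w).hasDerivAt (t : ℂ)).comp_ofReal).deriv
  have hk : derivative^[k] w = 0 := by
    obtain ⟨m, rfl⟩ := Nat.exists_eq_add_of_lt hl
    rw [show l + m + 1 = (m + 1) + l by ring, Function.iterate_add_apply, hw,
      iterate_derivative_zero]
  rw [key k, hk]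
  simp

theorem Qi_sq {k l : ℕ} (hl : l < k) (x : ℝ) :
    Qi k l x ^ 2 =
      (-1) ^ k * ((1 + (x : ℂ) ^ 2) ^ k * polyArctan (legendrePolyImag l) k x ^ 2) := by
  have hr : ((((1 + x ^ 2) ^ ((k : ℝ) / 2) : ℝ) : ℂ)) ^ 2 = (1 + (x : ℂ) ^ 2) ^ k := by
    have : ((1 + x ^ 2) ^ ((k : ℝ) / 2)) ^ 2 = (1 + x ^ 2) ^ k := by
      rw [← Real.rpow_natCast, ← Real.rpow_mul (by positivity), Nat.cast_ofNat,
        div_mul_cancel₀ _ two_ne_zero, Real.rpow_natCast]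
    exact_mod_cast this
  have hI : (Complex.I ^ (-(k : ℤ))) ^ 2 = (-1) ^ k := by
    rw [zpow_neg, zpow_natCast, inv_pow, ← pow_mul, mul_comm k, pow_mul, Complex.I_sq, ← inv_pow]
    norm_num
  have h1 : (((-1 : ℂ)) ^ k) ^ 2 = 1 := by
    rw [← pow_mul, mul_comm, pow_mul]
    norm_num
  rw [Qi, iteratedDeriv_legQ_imag hl, mul_pow, mul_pow, mul_pow, hr, hI, h1]
  ring

end LegendreQ

/-- Normalization integral of `Q^k_ℓ(i·x)` for `ℓ < k`. -/
theorem legendreQ_imag_norm (k l : ℕ) (hl : l < k) :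
    ∫ x : ℝ, (Qi k l x) ^ 2 =
      (((2 * l).factorial : ℂ)) * (Real.pi : ℂ) *
        (((∏ i ∈ Finset.Icc (l + 2) k, (((l : ℤ) + (i : ℤ)) * ((l : ℤ) - (i : ℤ) + 1))) : ℤ) : ℂ) := by
  have hV := isLegendreFamily_polyArctan l
  have hc := polyArctan_succ_eq (natDegree_legendrePolyImag_le l) (legendrePolyImag_ode l)
  simp_rw [Qi_sq hl]
  rw [integral_const_mul]
  induction k, (hl : l + 1 ≤ k) using Nat.le_induction with
  | base =>
    have hf : (l.factorial : ℂ) ≠ 0 := by exact_mod_cast l.factorial_ne_zero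
    have hp : ((2 * Complex.I) ^ l) ^ 2 = (-1) ^ l * 4 ^ l := by
      rw [← pow_mul, mul_comm l, pow_mul, mul_pow, Complex.I_sq, ← mul_pow]
      norm_num
    have h1 : ((-1 : ℂ) ^ l) ^ 2 = 1 := by
      rw [← pow_mul, mul_comm, pow_mul]
      norm_num
    rw [IsLegendreFamily.integral_base hc, eval_neg_I_legendrePolyImag, mul_pow, mul_pow, hp,
      Complex.I_sq, Finset.Icc_eq_empty (by omega), Finset.prod_empty]
    push_cast
    field_simp
    rw [Nat.succ_eq_add_one, pow_succ]
    linear_combination ((2 * l).factorial : ℂ) * h1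
  | succ k hk ih =>
    rw [hV.integral_succ hc hk, Finset.prod_Icc_succ_top (by omega), Int.cast_mul]
    push_cast at ih ⊢
    linear_combination (((l : ℂ) + (k + 1)) * (l - (k + 1) + 1)) * ih
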